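/- The left and right nuclei of B = A[X;*]^fl coincide, and N_l(B) = N_r(B) = { Σ_i a_i X^i : every even-indexed coefficient a_{2i} lies in Z(A), and every odd-indexed coefficient a_{2i+1} lies in C(A) ∩ N_m(A) and satisfies (a_{2i+1}·b)·c = a_{2i+1}·(c·b) and (b·c)·a_{2i+1} = c·(b·a_{2i+1}) for all b, c ∈ A }. -/

import Mathlib

/-- `tau n a b = ab` if `n` is even and `ba` if `n` is odd. -/
def tau {A : Type*} [NonAssocRing A] (n : ℕ) (a b : A) : A :=
  if Even n then a * b else b * a

/-- The `m`-fold iterate `*^m` of the involution `*`. -/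
def starIter {A : Type*} [NonAssocRing A] [StarRing A] : ℕ → A → A
  | 0, a => a
  | m+1, a => star (starIter m a)

/-- The multiplication of the flipped non-associative skew polynomial ring `B = A[X;*]^fl`:
the biadditive extension of `(aX^m)(bX^n) = τ_n(a, *^m(b)) X^{m+n}`. Polynomials are
represented as finitely supported functions `ℕ →₀ A`. -/
noncomputable def fmul {A : Type*} [NonAssocRing A] [StarRing A] (p q : ℕ →₀ A) : ℕ →₀ A :=
  p.sum fun m a => q.sum fun n b => Finsupp.single (m+n) (tau n a (starIter m b))

/-- The map `α : B → B`, `α(Σ_i a_i X^i) = Σ_i (−1)^i *^{i+1}(a_i) X^i`. -/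
noncomputable def alphaMap {A : Type*} [NonAssocRing A] [StarRing A] (p : ℕ →₀ A) : ℕ →₀ A :=
  p.sum fun i a => Finsupp.single i ((-1 : ℤ) ^ i • starIter (i+1) a)

/-- The map `β : B → B`, `β(Σ_i a_i X^i) = Σ_i *^{i+1}(a_i) X^i`. -/
noncomputable def betaMap {A : Type*} [NonAssocRing A] [StarRing A] (p : ℕ →₀ A) : ℕ →₀ A :=
  p.sum fun i a => Finsupp.single i (starIter (i+1) a)

section FlippedSkewPolynomial

variable {A : Type*} [NonAssocRing A]

@[simp]
theorem tau_zero_left (n : ℕ) (b : A) : tau n 0 b = 0 := by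
  simp [tau]

@[simp]
theorem tau_zero_right (n : ℕ) (a : A) : tau n a 0 = 0 := by
  simp [tau]

theorem tau_add_left (n : ℕ) (a a' b : A) : tau n (a + a') b = tau n a b + tau n a' b := by
  by_cases h : Even n <;> simp [tau, h, add_mul, mul_add]

theorem tau_add_right (n : ℕ) (a b b' : A) : tau n a (b + b') = tau n a b + tau n a b' := by
  by_cases h : Even n <;> simp [tau, h, add_mul, mul_add]

variable [StarRing A]

theorem starIter_eq_ite (m : ℕ) (a : A) : starIter m a = if Even m then a else star a := by
  induction m with
  | zero => simp [starIter]
  | succ m ih => by_cases h : Even m <;> simp [starIter, ih, h, Nat.even_add_one]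

@[simp]
theorem starIter_zero (m : ℕ) : starIter m (0 : A) = 0 := by
  simp [starIter_eq_ite]

theorem starIter_add (m : ℕ) (a b : A) :
    starIter m (a + b) = starIter m a + starIter m b := by
  by_cases h : Even m <;> simp [starIter_eq_ite, h]

theorem fmul_add_left (p p' q : ℕ →₀ A) : fmul (p + p') q = fmul p q + fmul p' q := by
  unfold fmul
  refine Finsupp.sum_add_index' (by simp) fun m a a' => ?_
  simp [tau_add_left, Finsupp.sum_add]

theorem fmul_add_right (p q q' : ℕ →₀ A) : fmul p (q + q') = fmul p q + fmul p q' := by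
  unfold fmul
  rw [← Finsupp.sum_add]
  refine Finsupp.sum_congr fun m _ => Finsupp.sum_add_index' (by simp) fun n b b' => ?_
  simp [starIter_add, tau_add_right]

/-- Multiplication of flipped skew polynomials as a biadditive map. -/
noncomputable def fmulHom : (ℕ →₀ A) →+ (ℕ →₀ A) →+ (ℕ →₀ A) :=
  AddMonoidHom.mk' (fun p => AddMonoidHom.mk' (fmul p) (fmul_add_right p)) fun p p' => by
    exact AddMonoidHom.ext fun q => fmul_add_left p p' q

theorem fmulHom_apply (p q : ℕ →₀ A) : fmulHom p q = fmul p q := rfl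

@[simp]
theorem fmul_zero_left (q : ℕ →₀ A) : fmul 0 q = 0 := by
  simp [fmul]

@[simp]
theorem fmul_zero_right (p : ℕ →₀ A) : fmul p 0 = 0 := by
  simp [fmul]

@[simp]
theorem fmul_single_single (m n : ℕ) (a b : A) :
    fmul (Finsupp.single m a) (Finsupp.single n b) =
      Finsupp.single (m + n) (tau n a (starIter m b)) := by
  simp [fmul]

theorem fmul_single_apply (p : ℕ →₀ A) (m n : ℕ) (b : A) :
    fmul p (Finsupp.single n b) (m + n) = tau n (p m) (starIter m b) := by
  induction p using Finsupp.induction_linear with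
  | zero => simp
  | add p q hp hq => simp [fmul_add_left, hp, hq, tau_add_left]
  | single i a => by_cases h : i = m <;> simp [h]

theorem single_fmul_apply (q : ℕ →₀ A) (m n : ℕ) (a : A) :
    fmul (Finsupp.single m a) q (m + n) = tau n a (starIter m (q n)) := by
  induction q using Finsupp.induction_linear with
  | zero => simp
  | add p q hp hq => simp [fmul_add_right, hp, hq, starIter_add, tau_add_right]
  | single i b => by_cases h : i = n <;> simp [h]

theorem AddMonoidHom.eq_of_eq_on_single_coeff {M N : Type*} [AddCommMonoid M] [AddCommMonoid N]
    (F G : (ℕ →₀ M) →+ N) (p : ℕ →₀ M)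
    (h : ∀ m, F (Finsupp.single m (p m)) = G (Finsupp.single m (p m))) : F p = G p := by
  rw [← p.sum_single, map_finsuppSum, map_finsuppSum]
  exact Finsupp.sum_congr fun m _ => h m

/-- The coefficient identity expressing `((aX^m)(bX^n))(cX^k) = (aX^m)((bX^n)(cX^k))`. -/
def MonomialAssoc (m n k : ℕ) (a b c : A) : Prop :=
  tau k (tau n a (starIter m b)) (starIter (m + n) c) =
    tau (n + k) a (starIter m (tau k b (starIter n c)))

theorem MonomialAssoc.fmul_assoc {m n k : ℕ} {a b c : A} (h : MonomialAssoc m n k a b c) :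
    fmul (fmul (Finsupp.single m a) (Finsupp.single n b)) (Finsupp.single k c) =
      fmul (Finsupp.single m a) (fmul (Finsupp.single n b) (Finsupp.single k c)) := by
  unfold MonomialAssoc at h
  simp only [fmul_single_single, h, add_assoc]

theorem fmul_left_assoc_iff (p : ℕ →₀ A) :
    (∀ q w, fmul (fmul p q) w = fmul p (fmul q w)) ↔
      ∀ m n k b c, MonomialAssoc m n k (p m) b c := by
  constructor
  · intro h m n k b c
    have := DFunLike.congr_fun (h (Finsupp.single n b) (Finsupp.single k c)) (m + n + k)
    rw [fmul_single_apply, fmul_single_apply, fmul_single_single, add_assoc m n k,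
      fmul_single_apply] at this
    exact this
  · intro h q w
    induction q using Finsupp.induction_linear with
    | zero => simp
    | add q q' hq hq' => simp [fmul_add_left, fmul_add_right, hq, hq']
    | single n b =>
      induction w using Finsupp.induction_linear with
      | zero => simp
      | add w w' hw hw' => simp [fmul_add_right, hw, hw']
      | single k c =>
        exact AddMonoidHom.eq_of_eq_on_single_coeff
          ((fmulHom.flip (Finsupp.single k c)).comp (fmulHom.flip (Finsupp.single n b)))
          (fmulHom.flip (fmul (Finsupp.single n b) (Finsupp.single k c))) p
          fun m => (h m n k b c).fmul_assoc

theorem fmul_right_assoc_iff (p : ℕ →₀ A) :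
    (∀ q w, fmul (fmul q w) p = fmul q (fmul w p)) ↔
      ∀ k m n b c, MonomialAssoc m n k b c (p k) := by
  constructor
  · intro h k m n b c
    have := DFunLike.congr_fun (h (Finsupp.single m b) (Finsupp.single n c)) (m + n + k)
    rw [fmul_single_single, single_fmul_apply, add_assoc m n k, single_fmul_apply,
      single_fmul_apply] at this
    exact this
  · intro h q w
    induction q using Finsupp.induction_linear with
    | zero => simp
    | add q q' hq hq' => simp [fmul_add_left, hq, hq']
    | single m b =>
      induction w using Finsupp.induction_linear with
      | zero => simp
      | add w w' hw hw' => simp [fmul_add_left, fmul_add_right, hw, hw']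
      | single n c =>
        exact AddMonoidHom.eq_of_eq_on_single_coeff
          (fmulHom (fmul (Finsupp.single m b) (Finsupp.single n c)))
          ((fmulHom (Finsupp.single m b)).comp (fmulHom (Finsupp.single n c))) p
          fun k => (h k m n b c).fmul_assoc

/-- Membership in the center of `A`. -/
def IsCentralCoeff (a : A) : Prop :=
  (∀ b : A, a * b = b * a) ∧
  (∀ b c : A, (a * b) * c = a * (b * c)) ∧
  (∀ b c : A, (b * a) * c = b * (a * c)) ∧
  (∀ b c : A, (b * c) * a = b * (c * a))

/-- The condition on odd-indexed coefficients of elements of the left and right nuclei. -/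
def IsFlipCentralCoeff (a : A) : Prop :=
  (∀ b : A, a * b = b * a) ∧
  (∀ b c : A, (b * a) * c = b * (a * c)) ∧
  (∀ b c : A, (a * b) * c = a * (c * b)) ∧
  (∀ b c : A, (b * c) * a = c * (b * a))

theorem IsCentralCoeff.star {a : A} (h : IsCentralCoeff a) : IsCentralCoeff (star a) := by
  obtain ⟨h1, h2, h3, h4⟩ := h
  refine ⟨fun b => ?_, fun b c => ?_, fun b c => ?_, fun b c => ?_⟩ <;> apply star_injective
  · simp [h1]
  · simp [h4]
  · simp [h3]
  · simp [h2]

theorem IsFlipCentralCoeff.star {a : A} (h : IsFlipCentralCoeff a) :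
    IsFlipCentralCoeff (star a) := by
  obtain ⟨h1, h2, h3, h4⟩ := h
  refine ⟨fun b => ?_, fun b c => ?_, fun b c => ?_, fun b c => ?_⟩ <;> apply star_injective
  · simp [h1]
  · simp [h2]
  · simp [h4]
  · simp [h3]

theorem monomialAssoc_left_even_iff {m : ℕ} (hm : Even m) (a : A) :
    (∀ n k b c, MonomialAssoc m n k a b c) ↔ IsCentralCoeff a := by
  simp only [MonomialAssoc, tau, starIter_eq_ite, Nat.even_add, hm, true_iff, if_true]
  constructor
  · intro h
    have h00 := h 0 0
    have h01 := h 0 1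
    have h10 := fun b c => h 1 0 b (star c)
    have h11 := fun b c => h 1 1 b (star c)
    simp at h00 h01 h10 h11
    have comm : ∀ b, a * b = b * a := fun b => by simpa using h01 b 1
    exact ⟨comm, h00, by grind, by grind⟩
  · rintro ⟨h1, h2, h3, h4⟩ n k b c
    by_cases hn : Even n <;> by_cases hk : Even k <;> simp [hn, hk] <;> grind

theorem monomialAssoc_left_odd_iff {m : ℕ} (hm : ¬Even m) (a : A) :
    (∀ n k b c, MonomialAssoc m n k a b c) ↔ IsFlipCentralCoeff a := by
  simp only [MonomialAssoc, tau, starIter_eq_ite, Nat.even_add, hm, false_iff, if_false]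
  constructor
  · intro h
    have h00 := fun b c => h 0 0 (star b) (star c)
    have h01 := fun b c => h 0 1 (star b) (star c)
    have h10 := fun b c => h 1 0 (star b) c
    have h11 := fun b c => h 1 1 (star b) c
    simp at h00 h01 h10 h11
    have comm : ∀ b, a * b = b * a := fun b => by simpa using h01 b 1
    exact ⟨comm, by grind, h00, by grind⟩
  · rintro ⟨h1, h2, h3, h4⟩ n k b c
    by_cases hn : Even n <;> by_cases hk : Even k <;> simp [hn, hk] <;> grind

theorem monomialAssoc_right_even_iff {k : ℕ} (hk : Even k) (a : A) :
    (∀ m n b c, MonomialAssoc m n k b c a) ↔ IsCentralCoeff a := by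
  simp only [MonomialAssoc, tau, starIter_eq_ite, Nat.even_add, hk, iff_true, if_true]
  constructor
  · intro h
    have h00 := h 0 0
    have h11 := fun b c => h 1 1 b (star c)
    simp at h00 h11
    have comm : ∀ b, a * b = b * a := fun b => by simpa using (h11 b 1).symm
    clear h
    have mid : ∀ b c, b * a * c = b * (a * c) := fun b c => by
      rw [← comm b, ← h11, h00, comm c]
    exact ⟨comm, by grind, mid, h00⟩
  · intro h m n b c
    obtain ⟨s1, s2, s3, s4⟩ := h.star
    obtain ⟨h1, h2, h3, h4⟩ := h
    by_cases hm : Even m <;> by_cases hn : Even n <;> simp [hm, hn] <;> grind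

theorem monomialAssoc_right_odd_iff {k : ℕ} (hk : ¬Even k) (a : A) :
    (∀ m n b c, MonomialAssoc m n k b c a) ↔ IsFlipCentralCoeff a := by
  simp only [MonomialAssoc, tau, starIter_eq_ite, Nat.even_add, hk, iff_false, if_false]
  constructor
  · intro h
    have h00 := h 0 0
    have h11 := fun b c => h 1 1 b (star c)
    simp at h00 h11
    have comm : ∀ b, a * b = b * a := fun b => by simpa using h11 b 1
    clear h
    have mid : ∀ b c, b * a * c = b * (a * c) := fun b c => by
      rw [← comm b, ← h00, h11, comm c]
    exact ⟨comm, mid, by grind, by grind⟩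
  · intro h m n b c
    obtain ⟨s1, s2, s3, s4⟩ := h.star
    obtain ⟨h1, h2, h3, h4⟩ := h
    by_cases hm : Even m <;> by_cases hn : Even n <;> simp [hm, hn] <;> grind

theorem forall_nat_iff_forall_even_and_forall_odd {P : ℕ → Prop} :
    (∀ m, P m) ↔ (∀ i, P (2 * i)) ∧ ∀ i, P (2 * i + 1) := by
  refine ⟨fun h => ⟨fun i => h _, fun i => h _⟩, fun ⟨h0, h1⟩ m => ?_⟩
  obtain ⟨i, rfl | rfl⟩ := m.even_or_odd'
  exacts [h0 i, h1 i]

end FlippedSkewPolynomial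

/-- the left and right nuclei of `B = A[X;*]^fl` coincide and consist of the
polynomials `Σ_i a_i X^i` such that every even-indexed coefficient lies in `Z(A)`, and every
odd-indexed coefficient `a = a_{2i+1}` lies in `C(A) ∩ N_m(A)` and satisfies
`(ab)c = a(cb)` and `(bc)a = c(ba)` for all `b, c ∈ A`. -/
theorem left_and_right_nucleus_flipped_skew_polynomial_ring
    {A : Type*} [NonAssocRing A] [StarRing A] :
    ∀ p : ℕ →₀ A,
      ((∀ q w : ℕ →₀ A, fmul (fmul p q) w = fmul p (fmul q w)) ↔
        (((∀ i : ℕ,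
            (∀ b : A, p (2 * i) * b = b * p (2 * i)) ∧
            (∀ b c : A, (p (2 * i) * b) * c = p (2 * i) * (b * c)) ∧
            (∀ b c : A, (b * p (2 * i)) * c = b * (p (2 * i) * c)) ∧
            (∀ b c : A, (b * c) * p (2 * i) = b * (c * p (2 * i)))) ∧
          (∀ i : ℕ,
            (∀ b : A, p (2 * i + 1) * b = b * p (2 * i + 1)) ∧
            (∀ b c : A, (b * p (2 * i + 1)) * c = b * (p (2 * i + 1) * c)) ∧
            (∀ b c : A, (p (2 * i + 1) * b) * c = p (2 * i + 1) * (c * b)) ∧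
            (∀ b c : A, (b * c) * p (2 * i + 1) = c * (b * p (2 * i + 1))))))) ∧
      ((∀ q w : ℕ →₀ A, fmul (fmul q w) p = fmul q (fmul w p)) ↔
        (((∀ i : ℕ,
            (∀ b : A, p (2 * i) * b = b * p (2 * i)) ∧
            (∀ b c : A, (p (2 * i) * b) * c = p (2 * i) * (b * c)) ∧
            (∀ b c : A, (b * p (2 * i)) * c = b * (p (2 * i) * c)) ∧
            (∀ b c : A, (b * c) * p (2 * i) = b * (c * p (2 * i)))) ∧
          (∀ i : ℕ,
            (∀ b : A, p (2 * i + 1) * b = b * p (2 * i + 1)) ∧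
            (∀ b c : A, (b * p (2 * i + 1)) * c = b * (p (2 * i + 1) * c)) ∧
            (∀ b c : A, (p (2 * i + 1) * b) * c = p (2 * i + 1) * (c * b)) ∧
            (∀ b c : A, (b * c) * p (2 * i + 1) = c * (b * p (2 * i + 1))))))) := by
  intro p
  constructor
  · rw [fmul_left_assoc_iff, forall_nat_iff_forall_even_and_forall_odd]
    exact and_congr
      (forall_congr' fun i => monomialAssoc_left_even_iff (even_two_mul i) _)
      (forall_congr' fun i => monomialAssoc_left_odd_iff (Nat.not_even_two_mul_add_one i) _)
  · rw [fmul_right_assoc_iff, forall_nat_iff_forall_even_and_forall_odd]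
    exact and_congr
      (forall_congr' fun i => monomialAssoc_right_even_iff (even_two_mul i) _)
      (forall_congr' fun i => monomialAssoc_right_odd_iff (Nat.not_even_two_mul_add_one i) _)
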